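/- Let A ∈ ℝ^{m×ℓ}, B ∈ ℝ^{ℓ×n} with rank(A) = rank(B) = ℓ, and b ∈ ℝ^m with b ∉ ran(AB). Let f : ℝ^n → ℝ be γ-strongly convex with differentiable conjugate f*, let x⋆ be the unique solution of: minimize f(x) subject to x ∈ argmin_z ‖b − ABz‖₂, and assume there exists ν > 0 such that D_{f,z}(x, x⋆) ≤ (1/ν)‖B(x − x⋆)‖₂² for all x ∈ ℝ^n and all z ∈ ∂f(x) ∩ ran(Bᵀ). Set α = 1 − σ_min²(A)/‖A‖_F² and β = 1 − γν/(2‖B‖_F²). Then for every δ > 0 and every k ≥ 1, the iterates of the RGS-RRK algorithm satisfy E[D_{f,z^{(k)}}(x^{(k)}, x⋆)] ≤ (1 + δ/γ)^k β^k D_{f,z^{(0)}}(x^{(0)}, x⋆) + ((δ+γ)γ/(2δ‖B‖_F²)) ‖A†‖₂² ‖AA†b‖₂² · Σ_{i=0}^{k−1} α^{k−i} (1 + δ/γ)^i β^i. -/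

import Mathlib

open Finset

noncomputable section

/-- Euclidean inner product on `ℝ^k`. -/
def dotp {k : ℕ} (x y : Fin k → ℝ) : ℝ := ∑ i, x i * y i

/-- Squared Euclidean norm on `ℝ^k`. -/
def sqnorm {k : ℕ} (x : Fin k → ℝ) : ℝ := ∑ i, (x i) ^ 2

/-- Subdifferential of `f` at `x`. -/
def subdiff {k : ℕ} (f : (Fin k → ℝ) → ℝ) (x : Fin k → ℝ) : Set (Fin k → ℝ) :=
  {z | ∀ y, f y ≥ f x + dotp z (y - x)}

/-- `f` is `γ`-strongly convex. -/
def StrongConvexWith {k : ℕ} (γ : ℝ) (f : (Fin k → ℝ) → ℝ) : Prop :=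
  ∀ x y z, z ∈ subdiff f x → f y ≥ f x + dotp z (y - x) + γ / 2 * sqnorm (y - x)

/-- Bregman distance between `x` and `y` with respect to `f` and `z ∈ ∂f(x)`. -/
def Dbreg {k : ℕ} (f : (Fin k → ℝ) → ℝ) (z x y : Fin k → ℝ) : ℝ :=
  f y - f x - dotp z (y - x)

open Matrix

/-- Euclidean norm on `ℝ^k`. -/
def nrm {k : ℕ} (x : Fin k → ℝ) : ℝ := Real.sqrt (sqnorm x)

/-- Squared Frobenius norm of a matrix. -/
def frobSq {m l : ℕ} (A : Matrix (Fin m) (Fin l) ℝ) : ℝ := ∑ i, ∑ j, (A i j) ^ 2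

/-- Square of the minimum singular value of a (full column rank) matrix. -/
def sminSq {m l : ℕ} (A : Matrix (Fin m) (Fin l) ℝ) : ℝ :=
  sInf {c : ℝ | ∃ v : Fin l → ℝ, sqnorm v = 1 ∧ c = sqnorm (A.mulVec v)}

/-- Square of the spectral norm (2-norm) of a matrix. -/
def spectralSq {m l : ℕ} (M : Matrix (Fin m) (Fin l) ℝ) : ℝ :=
  sSup {c : ℝ | ∃ v : Fin l → ℝ, sqnorm v = 1 ∧ c = sqnorm (M.mulVec v)}

/-- `P` is the Moore–Penrose pseudoinverse of `A` (Penrose conditions). -/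
def IsMoorePenrose {m l : ℕ} (A : Matrix (Fin m) (Fin l) ℝ)
    (P : Matrix (Fin l) (Fin m) ℝ) : Prop :=
  A * P * A = A ∧ P * A * P = P ∧ (A * P)ᵀ = A * P ∧ (P * A)ᵀ = P * A

/-- One step of the RGS-RRK algorithm: given the choice `c = (j, i)` of a column
of `A` and a row of `B`, and the current state `s = (y, z)`, perform one RGS step
for `min ‖b − Ay‖₂` followed by one RRK step for `B x = y` (with `x = Df z`). -/
def rgsrrkStep {m l n : ℕ} (A : Matrix (Fin m) (Fin l) ℝ) (B : Matrix (Fin l) (Fin n) ℝ)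
    (b : Fin m → ℝ) (γ : ℝ) (Df : (Fin n → ℝ) → (Fin n → ℝ)) (c : Fin l × Fin l)
    (s : (Fin l → ℝ) × (Fin n → ℝ)) : (Fin l → ℝ) × (Fin n → ℝ) :=
  let y' := Function.update s.1 c.1
      (s.1 c.1 + dotp (Aᵀ c.1) (b - A.mulVec s.1) / sqnorm (Aᵀ c.1))
  (y', s.2 - (γ * (dotp (B c.2) (Df s.2) - y' c.2) / sqnorm (B c.2)) • B c.2)

/-- The RGS-RRK iterate obtained from initial state `(y0, z0)` by applying one
step for each entry of the list of index choices. -/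
def rgsrrkIter {m l n : ℕ} (A : Matrix (Fin m) (Fin l) ℝ) (B : Matrix (Fin l) (Fin n) ℝ)
    (b : Fin m → ℝ) (γ : ℝ) (Df : (Fin n → ℝ) → (Fin n → ℝ))
    (y0 : Fin l → ℝ) (z0 : Fin n → ℝ) :
    List (Fin l × Fin l) → (Fin l → ℝ) × (Fin n → ℝ)
  | [] => (y0, z0)
  | c :: cs => rgsrrkStep A B b γ Df c (rgsrrkIter A B b γ Df y0 z0 cs)

section VectorAndMatrixBounds

lemma dotp_eq_dotProduct {k : ℕ} (x y : Fin k → ℝ) : dotp x y = x ⬝ᵥ y := rfl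

lemma sqnorm_eq_dotProduct {k : ℕ} (x : Fin k → ℝ) : sqnorm x = x ⬝ᵥ x := by
  simp [sqnorm, dotProduct, sq]

lemma sqnorm_nonneg {k : ℕ} (x : Fin k → ℝ) : 0 ≤ sqnorm x :=
  Finset.sum_nonneg fun _ _ => sq_nonneg _

lemma sqnorm_eq_zero {k : ℕ} {x : Fin k → ℝ} : sqnorm x = 0 ↔ x = 0 := by
  rw [sqnorm_eq_dotProduct, dotProduct_self_eq_zero]

lemma sqnorm_smul {k : ℕ} (a : ℝ) (x : Fin k → ℝ) : sqnorm (a • x) = a ^ 2 * sqnorm x := by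
  simp [sqnorm, mul_pow, Finset.mul_sum]

lemma sqnorm_neg {k : ℕ} (x : Fin k → ℝ) : sqnorm (-x) = sqnorm x := by
  simp [sqnorm]

lemma dotp_sq_le {k : ℕ} (x y : Fin k → ℝ) : dotp x y ^ 2 ≤ sqnorm x * sqnorm y :=
  Finset.sum_mul_sq_le_sq_mul_sq _ _ _

lemma sqnorm_add {k : ℕ} (x y : Fin k → ℝ) :
    sqnorm (x + y) = sqnorm x + 2 * dotp x y + sqnorm y := by
  simp only [sqnorm_eq_dotProduct, dotp_eq_dotProduct, add_dotProduct, dotProduct_add,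
    dotProduct_comm y x]
  ring

lemma frobSq_eq_sum_rows {m l : ℕ} (M : Matrix (Fin m) (Fin l) ℝ) :
    frobSq M = ∑ i, sqnorm (M i) := rfl

lemma frobSq_eq_sum_cols {m l : ℕ} (M : Matrix (Fin m) (Fin l) ℝ) :
    frobSq M = ∑ j, sqnorm (Mᵀ j) :=
  Finset.sum_comm

lemma frobSq_nonneg {m l : ℕ} (M : Matrix (Fin m) (Fin l) ℝ) : 0 ≤ frobSq M :=
  Finset.sum_nonneg fun i _ => sqnorm_nonneg (M i)

lemma sqnorm_mulVec_le_frobSq {m l : ℕ} (M : Matrix (Fin m) (Fin l) ℝ) (v : Fin l → ℝ) :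
    sqnorm (M *ᵥ v) ≤ frobSq M * sqnorm v := by
  rw [frobSq_eq_sum_rows, Finset.sum_mul]
  exact Finset.sum_le_sum fun i _ => dotp_sq_le (M i) v

lemma frobSq_pos_of_rank {m l : ℕ} (M : Matrix (Fin m) (Fin l) ℝ) (h : 0 < M.rank) :
    0 < frobSq M := by
  refine (frobSq_nonneg M).lt_of_ne' fun h0 => h.ne' ?_
  have hM : M = 0 := by
    rw [frobSq_eq_sum_rows, Finset.sum_eq_zero_iff_of_nonneg fun i _ => sqnorm_nonneg (M i)] at h0
    funext i
    exact sqnorm_eq_zero.1 (h0 i (Finset.mem_univ i))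
  simp [hM]

/-- The ratio `‖M v‖² / ‖v‖²` is attained at a unit vector. -/
lemma exists_unit_sqnorm_mulVec {m l : ℕ} (M : Matrix (Fin m) (Fin l) ℝ) {v : Fin l → ℝ}
    (hv : v ≠ 0) :
    ∃ u : Fin l → ℝ, sqnorm u = 1 ∧ sqnorm (M *ᵥ v) = sqnorm (M *ᵥ u) * sqnorm v := by
  have hpos : 0 < sqnorm v := (sqnorm_nonneg v).lt_of_ne' (mt sqnorm_eq_zero.1 hv)
  have hs : (Real.sqrt (sqnorm v))⁻¹ ^ 2 = (sqnorm v)⁻¹ := by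
    rw [inv_pow, Real.sq_sqrt hpos.le]
  refine ⟨(Real.sqrt (sqnorm v))⁻¹ • v, ?_, ?_⟩
  · rw [sqnorm_smul, hs, inv_mul_cancel₀ hpos.ne']
  · rw [mulVec_smul, sqnorm_smul, hs]
    field_simp

lemma sminSq_nonneg {m l : ℕ} (M : Matrix (Fin m) (Fin l) ℝ) : 0 ≤ sminSq M := by
  apply Real.sInf_nonneg
  rintro c ⟨v, -, rfl⟩
  exact sqnorm_nonneg _

lemma sminSq_le_sqnorm_mulVec {m l : ℕ} (M : Matrix (Fin m) (Fin l) ℝ) {v : Fin l → ℝ}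
    (hv : sqnorm v = 1) : sminSq M ≤ sqnorm (M *ᵥ v) := by
  refine csInf_le ⟨0, ?_⟩ ⟨v, hv, rfl⟩
  rintro c ⟨u, -, rfl⟩
  exact sqnorm_nonneg _

lemma sminSq_mul_sqnorm_le {m l : ℕ} (M : Matrix (Fin m) (Fin l) ℝ) (v : Fin l → ℝ) :
    sminSq M * sqnorm v ≤ sqnorm (M *ᵥ v) := by
  rcases eq_or_ne v 0 with rfl | hv
  · simp [sqnorm]
  · obtain ⟨u, hu, h⟩ := exists_unit_sqnorm_mulVec M hv
    rw [h]
    exact mul_le_mul_of_nonneg_right (sminSq_le_sqnorm_mulVec M hu) (sqnorm_nonneg v)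

lemma sqnorm_mulVec_le_spectralSq {m l : ℕ} (M : Matrix (Fin m) (Fin l) ℝ) (v : Fin l → ℝ) :
    sqnorm (M *ᵥ v) ≤ spectralSq M * sqnorm v := by
  rcases eq_or_ne v 0 with rfl | hv
  · simp [sqnorm]
  · obtain ⟨u, hu, h⟩ := exists_unit_sqnorm_mulVec M hv
    rw [h]
    refine mul_le_mul_of_nonneg_right (le_csSup ⟨frobSq M, ?_⟩ ⟨u, hu, rfl⟩) (sqnorm_nonneg v)
    rintro c ⟨w, hw, rfl⟩
    simpa [hw] using sqnorm_mulVec_le_frobSq M w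

lemma spectralSq_nonneg {m l : ℕ} (M : Matrix (Fin m) (Fin l) ℝ) : 0 ≤ spectralSq M := by
  apply Real.sSup_nonneg
  rintro c ⟨v, -, rfl⟩
  exact sqnorm_nonneg _

lemma sminSq_le_frobSq {m l : ℕ} (M : Matrix (Fin m) (Fin l) ℝ) : sminSq M ≤ frobSq M := by
  by_cases h : ∃ v : Fin l → ℝ, sqnorm v = 1
  · obtain ⟨v, hv⟩ := h
    calc sminSq M ≤ sqnorm (M *ᵥ v) := sminSq_le_sqnorm_mulVec M hv
      _ ≤ frobSq M * sqnorm v := sqnorm_mulVec_le_frobSq M v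
      _ = frobSq M := by rw [hv, mul_one]
  · have : sminSq M = 0 := by
      have hempty : {c : ℝ | ∃ v : Fin l → ℝ, sqnorm v = 1 ∧ c = sqnorm (M.mulVec v)} = ∅ := by
        ext c
        simpa using fun v hv => (h ⟨v, hv⟩).elim
      rw [sminSq, hempty, Real.sInf_empty]
    rw [this]
    exact frobSq_nonneg M

lemma sqnorm_mulVec_eq_dotp {m l : ℕ} (M : Matrix (Fin m) (Fin l) ℝ) (w : Fin l → ℝ) :
    sqnorm (M *ᵥ w) = dotp w (Mᵀ *ᵥ (M *ᵥ w)) := by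
  rw [sqnorm_eq_dotProduct, dotp_eq_dotProduct, dotProduct_mulVec w, vecMul_transpose]

/-- On the range of `M`, the transpose of `M` is bounded below by the least singular value. -/
lemma sminSq_mul_sqnorm_mulVec_le {m l : ℕ} (M : Matrix (Fin m) (Fin l) ℝ) (w : Fin l → ℝ) :
    sminSq M * sqnorm (M *ᵥ w) ≤ sqnorm (Mᵀ *ᵥ (M *ᵥ w)) := by
  rcases (sqnorm_nonneg (M *ᵥ w)).eq_or_lt with h0 | hpos
  · rw [← h0, mul_zero]
    exact sqnorm_nonneg _
  · refine le_of_mul_le_mul_right ?_ hpos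
    calc sminSq M * sqnorm (M *ᵥ w) * sqnorm (M *ᵥ w)
        = sminSq M * dotp w (Mᵀ *ᵥ (M *ᵥ w)) ^ 2 := by rw [← sqnorm_mulVec_eq_dotp]; ring
      _ ≤ sminSq M * (sqnorm w * sqnorm (Mᵀ *ᵥ (M *ᵥ w))) :=
          mul_le_mul_of_nonneg_left (dotp_sq_le _ _) (sminSq_nonneg M)
      _ = sqnorm (Mᵀ *ᵥ (M *ᵥ w)) * (sminSq M * sqnorm w) := by ring
      _ ≤ sqnorm (Mᵀ *ᵥ (M *ᵥ w)) * sqnorm (M *ᵥ w) :=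
          mul_le_mul_of_nonneg_left (sminSq_mul_sqnorm_le M w) (sqnorm_nonneg _)

lemma mulVec_surjective_of_rank {l n : ℕ} (B : Matrix (Fin l) (Fin n) ℝ) (hB : B.rank = l) :
    Function.Surjective B.mulVec := by
  have h : LinearMap.range B.mulVecLin = ⊤ := by
    apply Submodule.eq_top_of_finrank_eq
    rw [← Matrix.rank, hB, Module.finrank_fin_fun]
  exact LinearMap.range_eq_top.1 h

lemma mulVec_injective_of_rank {m l : ℕ} (A : Matrix (Fin m) (Fin l) ℝ) (hA : A.rank = l) :
    Function.Injective A.mulVec := by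
  have h : LinearMap.ker A.mulVecLin = ⊥ := by
    have := A.mulVecLin.finrank_range_add_finrank_ker
    rw [← Matrix.rank, hA, Module.finrank_fin_fun] at this
    exact Submodule.finrank_eq_zero.1 (by omega)
  exact LinearMap.ker_eq_bot.1 h

end VectorAndMatrixBounds

section LeastSquares

variable {m l n : ℕ} {A : Matrix (Fin m) (Fin l) ℝ} {Adag : Matrix (Fin l) (Fin m) ℝ}

lemma IsMoorePenrose.mulVec_mulVec_cancel (h : IsMoorePenrose A Adag) (hA : A.rank = l)
    (w : Fin l → ℝ) : Adag *ᵥ (A *ᵥ w) = w := by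
  apply mulVec_injective_of_rank A hA
  rw [mulVec_mulVec, mulVec_mulVec, h.1]

lemma IsMoorePenrose.transpose_mulVec_residual (h : IsMoorePenrose A Adag) (b : Fin m → ℝ) :
    Aᵀ *ᵥ (b - A *ᵥ (Adag *ᵥ b)) = 0 := by
  have hT : Aᵀ * (A * Adag) = Aᵀ := by
    rw [← h.2.2.1, ← transpose_mul, h.1]
  rw [mulVec_sub, mulVec_mulVec, mulVec_mulVec, Matrix.mul_assoc, hT, sub_self]

/-- A least-squares solution of `A B x = b` is mapped by `B` to `A† b`. -/
lemma IsMoorePenrose.mulVec_eq_of_isLeast (h : IsMoorePenrose A Adag) (hA : A.rank = l)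
    {B : Matrix (Fin l) (Fin n) ℝ} (hB : B.rank = l) {b : Fin m → ℝ} {x : Fin n → ℝ}
    (hx : ∀ u, nrm (b - (A * B).mulVec x) ≤ nrm (b - (A * B).mulVec u)) :
    B *ᵥ x = Adag *ᵥ b := by
  obtain ⟨u, hu⟩ := mulVec_surjective_of_rank B hB (Adag *ᵥ b)
  have hle := (Real.sqrt_le_sqrt_iff (sqnorm_nonneg _)).1 (hx u)
  rw [← mulVec_mulVec, ← mulVec_mulVec, hu] at hle
  have hsplit : b - A *ᵥ (B *ᵥ x)
      = (b - A *ᵥ (Adag *ᵥ b)) + A *ᵥ (Adag *ᵥ b - B *ᵥ x) := by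
    rw [mulVec_sub]; abel
  have hperp : dotp (b - A *ᵥ (Adag *ᵥ b)) (A *ᵥ (Adag *ᵥ b - B *ᵥ x)) = 0 := by
    rw [dotp_eq_dotProduct, dotProduct_mulVec, ← mulVec_transpose,
      h.transpose_mulVec_residual, zero_dotProduct]
  rw [hsplit, sqnorm_add, hperp] at hle
  have h0 : A *ᵥ (Adag *ᵥ b - B *ᵥ x) = 0 :=
    sqnorm_eq_zero.1 (le_antisymm (by linarith) (sqnorm_nonneg _))
  have := h.mulVec_mulVec_cancel hA (Adag *ᵥ b - B *ᵥ x)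
  rw [h0, mulVec_zero] at this
  exact (sub_eq_zero.1 this.symm).symm

end LeastSquares

section Bregman

variable {n : ℕ} {f : (Fin n → ℝ) → ℝ} {γ : ℝ}

lemma StrongConvexWith.le_Dbreg (hsc : StrongConvexWith γ f) {x y z : Fin n → ℝ}
    (hz : z ∈ subdiff f x) : γ / 2 * sqnorm (y - x) ≤ Dbreg f z x y := by
  have := hsc x y z hz
  unfold Dbreg
  linarith

lemma Dbreg_nonneg {x y z : Fin n → ℝ} (hz : z ∈ subdiff f x) : 0 ≤ Dbreg f z x y := by
  have := hz y
  unfold Dbreg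
  linarith

/-- Descent inequality: moving the subgradient by `h` changes the Bregman distance to `y` by at
most the first-order term plus `‖h‖² / (2γ)`. -/
lemma StrongConvexWith.Dbreg_le_add (hsc : StrongConvexWith γ f) (hγ : 0 < γ)
    {x x' z h : Fin n → ℝ} (hz : z ∈ subdiff f x) (y : Fin n → ℝ) :
    Dbreg f (z + h) x' y ≤ Dbreg f z x y + dotp h (x - y) + sqnorm h / (2 * γ) := by
  have h1 := hsc x x' z hz
  have h2 : 0 ≤ sqnorm (h + (-γ) • (x' - x)) := sqnorm_nonneg _
  rw [sqnorm_add, sqnorm_smul] at h2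
  have h3 : dotp h (x' - x) ≤ sqnorm h / (2 * γ) + γ / 2 * sqnorm (x' - x) := by
    have h4 : dotp h ((-γ) • (x' - x)) = -γ * dotp h (x' - x) := by
      simp [dotp_eq_dotProduct]
    rw [h4] at h2
    have h5 : sqnorm h / (2 * γ) + γ / 2 * sqnorm (x' - x) - dotp h (x' - x)
        = (sqnorm h + 2 * (-γ * dotp h (x' - x)) + (-γ) ^ 2 * sqnorm (x' - x)) / (2 * γ) := by
      field_simp
      ring
    have h6 := div_nonneg h2 (by positivity : 0 ≤ 2 * γ)
    linarith
  unfold Dbreg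
  simp only [dotp_eq_dotProduct, dotProduct_sub, add_dotProduct] at *
  linarith

end Bregman

section ListExpectation

variable {ι : Type*} [Fintype ι]

/-- Expectation of `G` over lists of `k` independent choices, each with weights `w`. -/
def listExpect (w : ι → ℝ) (k : ℕ) (G : List ι → ℝ) : ℝ :=
  ∑ s : Fin k → ι, (∏ t, w (s t)) * G (List.ofFn s)

lemma listExpect_zero (w : ι → ℝ) (G : List ι → ℝ) : listExpect w 0 G = G [] := by
  simp [listExpect]

lemma listExpect_succ (w : ι → ℝ) (k : ℕ) (G : List ι → ℝ) :
    listExpect w (k + 1) G = listExpect w k fun cs => ∑ c, w c * G (c :: cs) := by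
  unfold listExpect
  rw [← (Fin.consEquiv fun _ : Fin (k + 1) => ι).sum_comp, Fintype.sum_prod_type_right]
  refine Finset.sum_congr rfl fun s _ => ?_
  rw [Finset.mul_sum]
  refine Finset.sum_congr rfl fun c _ => ?_
  simp only [Fin.consEquiv_apply, Fin.prod_univ_succ, Fin.cons_zero, Fin.cons_succ,
    List.ofFn_succ]
  ring

lemma listExpect_mono {w : ι → ℝ} (hw : ∀ c, 0 ≤ w c) (k : ℕ) {G H : List ι → ℝ}
    (h : ∀ cs, G cs ≤ H cs) : listExpect w k G ≤ listExpect w k H :=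
  Finset.sum_le_sum fun _ _ =>
    mul_le_mul_of_nonneg_left (h _) (Finset.prod_nonneg fun _ _ => hw _)

lemma listExpect_mul_add_mul (w : ι → ℝ) (k : ℕ) (a c : ℝ) (G H : List ι → ℝ) :
    listExpect w k (fun cs => a * G cs + c * H cs)
      = a * listExpect w k G + c * listExpect w k H := by
  unfold listExpect
  rw [Finset.mul_sum, Finset.mul_sum, ← Finset.sum_add_distrib]
  exact Finset.sum_congr rfl fun _ _ => by ring

lemma listExpect_le_geometric {w : ι → ℝ} (hw : ∀ c, 0 ≤ w c) {α : ℝ} (hα : 0 ≤ α)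
    {V : List ι → ℝ} (hV : ∀ cs, ∑ c, w c * V (c :: cs) ≤ α * V cs) (k : ℕ) :
    listExpect w k V ≤ α ^ k * V [] := by
  induction k with
  | zero => simp [listExpect_zero]
  | succ k ih =>
    rw [listExpect_succ]
    calc _ ≤ listExpect w k fun cs => α * V cs + 0 * V cs :=
          listExpect_mono hw k fun cs => by simpa using hV cs
      _ = α * listExpect w k V := by rw [listExpect_mul_add_mul, zero_mul, add_zero]
      _ ≤ α * (α ^ k * V []) := mul_le_mul_of_nonneg_left ih hα
      _ = α ^ (k + 1) * V [] := by ring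

/-- Solution of the coupled recursion `E V⁺ ≤ α E V`, `E D⁺ ≤ β E D + κ α E V`. -/
lemma listExpect_le_coupled {w : ι → ℝ} (hw : ∀ c, 0 ≤ w c) {α β κ : ℝ} (hα : 0 ≤ α)
    (hβ : 0 ≤ β) (hκ : 0 ≤ κ) {V D : List ι → ℝ}
    (hV : ∀ cs, ∑ c, w c * V (c :: cs) ≤ α * V cs)
    (hD : ∀ cs, ∑ c, w c * D (c :: cs) ≤ β * D cs + κ * α * V cs) (k : ℕ) :
    listExpect w k D
      ≤ β ^ k * D [] + κ * V [] * ∑ i ∈ Finset.range k, α ^ (k - i) * β ^ i := by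
  induction k with
  | zero => simp [listExpect_zero]
  | succ k ih =>
    rw [listExpect_succ]
    have hsum : ∑ i ∈ Finset.range (k + 1), α ^ (k + 1 - i) * β ^ i
        = β * (∑ i ∈ Finset.range k, α ^ (k - i) * β ^ i) + α ^ (k + 1) := by
      rw [Finset.sum_range_succ', Finset.mul_sum]
      congr 1
      · refine Finset.sum_congr rfl fun i _ => ?_
        rw [Nat.add_sub_add_right, pow_succ]
        ring
      · simp
    calc _ ≤ listExpect w k fun cs => β * D cs + κ * α * V cs := listExpect_mono hw k hD
      _ = β * listExpect w k D + κ * α * listExpect w k V := listExpect_mul_add_mul ..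
      _ ≤ β * (β ^ k * D [] + κ * V [] * ∑ i ∈ Finset.range k, α ^ (k - i) * β ^ i)
            + κ * α * (α ^ k * V []) :=
          add_le_add (mul_le_mul_of_nonneg_left ih hβ)
            (mul_le_mul_of_nonneg_left (listExpect_le_geometric hw hα hV k) (by positivity))
      _ = _ := by rw [hsum]; ring

end ListExpectation

section Step

variable {m l n : ℕ} {A : Matrix (Fin m) (Fin l) ℝ} {B : Matrix (Fin l) (Fin n) ℝ}
  {b : Fin m → ℝ} {γ : ℝ} {Df : (Fin n → ℝ) → (Fin n → ℝ)}

/-- The Gauss–Seidel update of the `j`-th coordinate of `y`. -/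
def gsUpdate (A : Matrix (Fin m) (Fin l) ℝ) (b : Fin m → ℝ) (j : Fin l) (y : Fin l → ℝ) :
    Fin l → ℝ :=
  Function.update y j (y j + dotp (Aᵀ j) (b - A.mulVec y) / sqnorm (Aᵀ j))

lemma gsUpdate_eq (j : Fin l) (y : Fin l → ℝ) :
    gsUpdate A b j y
      = y + (dotp (Aᵀ j) (b - A *ᵥ y) / sqnorm (Aᵀ j)) • (Pi.single j 1 : Fin l → ℝ) := by
  ext i
  rcases eq_or_ne i j with rfl | h
  · simp [gsUpdate]
  · simp [gsUpdate, h]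

/-- Each Gauss–Seidel update removes from the error the component along the chosen column. -/
lemma sqnorm_mul_sqnorm_gsUpdate {ystar : Fin l → ℝ} (hstar : Aᵀ *ᵥ (b - A *ᵥ ystar) = 0)
    (j : Fin l) (y : Fin l → ℝ) :
    sqnorm (Aᵀ j) * sqnorm (A *ᵥ (gsUpdate A b j y - ystar))
      = sqnorm (Aᵀ j) * sqnorm (A *ᵥ (y - ystar)) - (Aᵀ *ᵥ (A *ᵥ (y - ystar))) j ^ 2 := by
  have hres : dotp (Aᵀ j) (b - A *ᵥ y) = -(Aᵀ *ᵥ (A *ᵥ (y - ystar))) j := by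
    have h1 : b - A *ᵥ y = (b - A *ᵥ ystar) - A *ᵥ (y - ystar) := by
      rw [mulVec_sub]; abel
    change (Aᵀ *ᵥ (b - A *ᵥ y)) j = _
    rw [h1, mulVec_sub, hstar]
    simp
  set t := (Aᵀ *ᵥ (A *ᵥ (y - ystar))) j
  have hdot : dotp (A *ᵥ (y - ystar)) (Aᵀ j) = t := dotProduct_comm _ _
  have herr : A *ᵥ (gsUpdate A b j y - ystar)
      = A *ᵥ (y - ystar) + (-t / sqnorm (Aᵀ j)) • Aᵀ j := by
    rw [gsUpdate_eq, hres, add_sub_right_comm, mulVec_add, mulVec_smul, mulVec_single_one]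
    rfl
  have hdots (a : ℝ) : dotp (A *ᵥ (y - ystar)) (a • Aᵀ j) = a * t := by
    rw [← hdot]; simp [dotp_eq_dotProduct]
  rcases (sqnorm_nonneg (Aᵀ j)).eq_or_lt with h0 | hpos
  · have ht0 : t = 0 := by
      rw [← hdot, sqnorm_eq_zero.1 h0.symm]
      simp [dotp_eq_dotProduct]
    rw [← h0, ht0]
    ring
  · rw [herr, sqnorm_add, sqnorm_smul, hdots]
    field_simp
    ring

lemma sum_sqnorm_gsUpdate_le {ystar : Fin l → ℝ} (hstar : Aᵀ *ᵥ (b - A *ᵥ ystar) = 0)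
    (hA : 0 < frobSq A) (y : Fin l → ℝ) :
    ∑ j, sqnorm (Aᵀ j) / frobSq A * sqnorm (A *ᵥ (gsUpdate A b j y - ystar))
      ≤ (1 - sminSq A / frobSq A) * sqnorm (A *ᵥ (y - ystar)) := by
  have hsum : ∑ j, sqnorm (Aᵀ j) / frobSq A * sqnorm (A *ᵥ (gsUpdate A b j y - ystar))
      = (frobSq A * sqnorm (A *ᵥ (y - ystar)) - sqnorm (Aᵀ *ᵥ (A *ᵥ (y - ystar))))
        / frobSq A := by
    simp_rw [div_mul_eq_mul_div, sqnorm_mul_sqnorm_gsUpdate hstar]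
    rw [← Finset.sum_div, Finset.sum_sub_distrib, ← Finset.sum_mul, ← frobSq_eq_sum_cols]
    rfl
  rw [hsum, div_le_iff₀ hA]
  have := sminSq_mul_sqnorm_mulVec_le A (y - ystar)
  have h2 : (1 - sminSq A / frobSq A) * sqnorm (A *ᵥ (y - ystar)) * frobSq A
      = frobSq A * sqnorm (A *ᵥ (y - ystar)) - sminSq A * sqnorm (A *ᵥ (y - ystar)) := by
    field_simp
  linarith

/-- The Bregman–Kaczmarz update of `z` for the `i`-th equation of `B x = y`. -/
def kaczmarzUpdate (B : Matrix (Fin l) (Fin n) ℝ) (γ : ℝ) (Df : (Fin n → ℝ) → (Fin n → ℝ))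
    (i : Fin l) (y : Fin l → ℝ) (z : Fin n → ℝ) : Fin n → ℝ :=
  z - (γ * (dotp (B i) (Df z) - y i) / sqnorm (B i)) • B i

lemma kaczmarzUpdate_mem_range (i : Fin l) (y : Fin l → ℝ) {z : Fin n → ℝ}
    (hz : z ∈ Set.range Bᵀ.mulVec) :
    kaczmarzUpdate B γ Df i y z ∈ Set.range Bᵀ.mulVec := by
  obtain ⟨v, rfl⟩ := hz
  set a := γ * (dotp (B i) (Df (Bᵀ *ᵥ v)) - y i) / sqnorm (B i)
  refine ⟨v - a • Pi.single i 1, ?_⟩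
  rw [mulVec_sub, mulVec_smul, mulVec_single_one]
  rfl

lemma rgsrrkIter_mem_range (y0 : Fin l → ℝ) {z0 : Fin n → ℝ}
    (hz0 : z0 ∈ Set.range Bᵀ.mulVec) (cs : List (Fin l × Fin l)) :
    (rgsrrkIter A B b γ Df y0 z0 cs).2 ∈ Set.range Bᵀ.mulVec := by
  induction cs with
  | nil => exact hz0
  | cons c cs ih => exact kaczmarzUpdate_mem_range c.2 _ ih

variable {f : (Fin n → ℝ) → ℝ}

lemma sqnorm_mul_Dbreg_kaczmarzUpdate_le (hsc : StrongConvexWith γ f) (hγ : 0 < γ)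
    (hDf : ∀ x z, z ∈ subdiff f x ↔ x = Df z) (xstar : Fin n → ℝ) (i : Fin l)
    (y : Fin l → ℝ) (z : Fin n → ℝ) :
    sqnorm (B i) * Dbreg f (kaczmarzUpdate B γ Df i y z) (Df (kaczmarzUpdate B γ Df i y z)) xstar
      ≤ sqnorm (B i) * Dbreg f z (Df z) xstar
        - γ / 2 * ((B *ᵥ (Df z - xstar)) i ^ 2 - (y - B *ᵥ xstar) i ^ 2) := by
  set u := (B *ᵥ (Df z - xstar)) i with hu
  set e := (y - B *ᵥ xstar) i with he
  have hr : dotp (B i) (Df z) - y i = u - e := by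
    rw [hu, he, mulVec_sub]
    simp only [Pi.sub_apply]
    rw [show dotp (B i) (Df z) = (B *ᵥ Df z) i from rfl]
    ring
  rcases (sqnorm_nonneg (B i)).eq_or_lt with h0 | hpos
  · have hu0 : u = 0 := by
      change B i ⬝ᵥ (Df z - xstar) = 0
      rw [sqnorm_eq_zero.1 h0.symm, zero_dotProduct]
    rw [← h0, hu0]
    nlinarith [sq_nonneg e]
  · have hstep : kaczmarzUpdate B γ Df i y z
        = z + (-(γ * (u - e) / sqnorm (B i))) • B i := by
      rw [kaczmarzUpdate, hr, neg_smul, sub_eq_add_neg]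
    have hdot (a : ℝ) : dotp (a • B i) (Df z - xstar) = a * u := by
      rw [dotp_eq_dotProduct, smul_dotProduct]; rfl
    have hle := hsc.Dbreg_le_add hγ (x' := Df (kaczmarzUpdate B γ Df i y z))
      (h := (-(γ * (u - e) / sqnorm (B i))) • B i) ((hDf (Df z) z).2 rfl) xstar
    rw [← hstep, hdot, sqnorm_smul] at hle
    refine (mul_le_mul_of_nonneg_left hle hpos.le).trans_eq ?_
    field_simp
    ring

lemma sum_Dbreg_kaczmarzUpdate_le (hsc : StrongConvexWith γ f) (hγ : 0 < γ)
    (hDf : ∀ x z, z ∈ subdiff f x ↔ x = Df z) {xstar : Fin n → ℝ} {ν : ℝ} (hν : 0 < ν)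
    (hnu : ∀ x z, z ∈ subdiff f x → z ∈ Set.range Bᵀ.mulVec →
      Dbreg f z x xstar ≤ (1 / ν) * sqnorm (B.mulVec (x - xstar)))
    (hB : 0 < frobSq B) (y : Fin l → ℝ) {z : Fin n → ℝ} (hz : z ∈ Set.range Bᵀ.mulVec) :
    ∑ i, sqnorm (B i) / frobSq B *
        Dbreg f (kaczmarzUpdate B γ Df i y z) (Df (kaczmarzUpdate B γ Df i y z)) xstar
      ≤ (1 - γ * ν / (2 * frobSq B)) * Dbreg f z (Df z) xstar
        + γ / (2 * frobSq B) * sqnorm (y - B *ᵥ xstar) := by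
  have hsum := Finset.sum_le_sum fun i (_ : i ∈ Finset.univ) =>
    sqnorm_mul_Dbreg_kaczmarzUpdate_le (B := B) hsc hγ hDf xstar i y z
  rw [Finset.sum_sub_distrib, ← Finset.sum_mul, ← frobSq_eq_sum_rows, ← Finset.mul_sum,
    Finset.sum_sub_distrib] at hsum
  change _ ≤ _ - γ / 2 * (sqnorm (B *ᵥ (Df z - xstar)) - sqnorm (y - B *ᵥ xstar)) at hsum
  have hbound := hnu (Df z) z ((hDf _ _).2 rfl) hz
  rw [one_div, inv_mul_eq_div, le_div_iff₀ hν] at hbound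
  have hlhs (E : Fin l → ℝ) :
      ∑ i, sqnorm (B i) / frobSq B * E i = (∑ i, sqnorm (B i) * E i) / frobSq B := by
    simp_rw [div_mul_eq_mul_div, Finset.sum_div]
  rw [hlhs, div_le_iff₀ hB]
  have hrhs : ((1 - γ * ν / (2 * frobSq B)) * Dbreg f z (Df z) xstar
        + γ / (2 * frobSq B) * sqnorm (y - B *ᵥ xstar)) * frobSq B
      = frobSq B * Dbreg f z (Df z) xstar - γ / 2 * (Dbreg f z (Df z) xstar * ν)
        + γ / 2 * sqnorm (y - B *ᵥ xstar) := by
    field_simp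
  rw [hrhs]
  nlinarith [mul_le_mul_of_nonneg_left hbound (by positivity : 0 ≤ γ / 2)]

/-- The error-bound constant is compatible with strong convexity, so that the contraction factor
of the Kaczmarz step is nonnegative. -/
lemma mul_le_two_mul_frobSq (hsc : StrongConvexWith γ f)
    (hDf : ∀ x z, z ∈ subdiff f x ↔ x = Df z) {xstar : Fin n → ℝ} {ν : ℝ} (hν : 0 < ν)
    (hnu : ∀ x z, z ∈ subdiff f x → z ∈ Set.range Bᵀ.mulVec →
      Dbreg f z x xstar ≤ (1 / ν) * sqnorm (B.mulVec (x - xstar)))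
    (hB : 0 < frobSq B) : γ * ν ≤ 2 * frobSq B := by
  obtain ⟨z, hz, hne⟩ : ∃ z ∈ Set.range Bᵀ.mulVec, Df z ≠ xstar := by
    by_contra! hall
    obtain ⟨i, hi⟩ : ∃ i, 0 < sqnorm (B i) := by
      by_contra! hle
      exact hB.not_ge (Finset.sum_nonpos fun i _ => hle i)
    have hunbdd (t : ℝ) : t * sqnorm (B i) ≤ f (xstar + B i) - f xstar := by
      have hmem : t • B i ∈ Set.range Bᵀ.mulVec :=
        ⟨t • Pi.single i 1, by rw [mulVec_smul, mulVec_single_one]; rfl⟩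
      have hsub := (hDf xstar (t • B i)).2 (hall _ hmem).symm (xstar + B i)
      rw [add_sub_cancel_left, dotp_eq_dotProduct, smul_dotProduct, ← sqnorm_eq_dotProduct,
        smul_eq_mul] at hsub
      linarith
    have := hunbdd ((f (xstar + B i) - f xstar + 1) / sqnorm (B i))
    rw [div_mul_cancel₀ _ hi.ne'] at this
    linarith
  have hzsub : z ∈ subdiff f (Df z) := (hDf _ _).2 rfl
  have hpos : 0 < sqnorm (Df z - xstar) :=
    (sqnorm_nonneg _).lt_of_ne' (mt sqnorm_eq_zero.1 (sub_ne_zero.2 hne))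
  have hlow := hsc.le_Dbreg (y := xstar) hzsub
  rw [← neg_sub, sqnorm_neg] at hlow
  have hup := hnu _ z hzsub hz
  rw [one_div, inv_mul_eq_div, le_div_iff₀ hν] at hup
  have hfrob := sqnorm_mulVec_le_frobSq B (Df z - xstar)
  refine le_of_mul_le_mul_right ?_ hpos
  nlinarith [mul_le_mul_of_nonneg_right hlow hν.le]

end Step

/-- Convergence of the RGS-RRK algorithm (Theorem 3.2): for the
inconsistent case `b ∉ ran(AB)`, the expectation over the random index choices of
the Bregman distance of the `k`-th iterate to `x⋆` satisfies the stated bound.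
Here `Df = ∇f*` is characterized by `z ∈ ∂f(x) ↔ x = Df z`, a pair `(j, i)` of a
column index of `A` and a row index of `B` is chosen with probability
`(‖A_{:,j}‖²/‖A‖_F²)·(‖B_{i,:}‖²/‖B‖_F²)`, and `x^{(k)} = Df z^{(k)}`. -/
theorem rgs_rrk_convergence {m l n : ℕ}
    (A : Matrix (Fin m) (Fin l) ℝ) (B : Matrix (Fin l) (Fin n) ℝ)
    (b : Fin m → ℝ) (Adag : Matrix (Fin l) (Fin m) ℝ)
    (hA : A.rank = l) (hB : B.rank = l) (hAdag : IsMoorePenrose A Adag)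
    (hb : ¬ ∃ x, (A * B).mulVec x = b)
    (f : (Fin n → ℝ) → ℝ) (γ : ℝ) (hγ : 0 < γ) (hsc : StrongConvexWith γ f)
    (Df : (Fin n → ℝ) → (Fin n → ℝ)) (hDf : ∀ x z, z ∈ subdiff f x ↔ x = Df z)
    (xstar : Fin n → ℝ)
    (hfeas : ∀ u, nrm (b - (A * B).mulVec xstar) ≤ nrm (b - (A * B).mulVec u))
    (hmin : ∀ x, (∀ u, nrm (b - (A * B).mulVec x) ≤ nrm (b - (A * B).mulVec u)) →
      f xstar ≤ f x)
    (ν : ℝ) (hν : 0 < ν)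
    (hnu : ∀ x z, z ∈ subdiff f x → z ∈ Set.range Bᵀ.mulVec →
      Dbreg f z x xstar ≤ (1 / ν) * sqnorm (B.mulVec (x - xstar)))
    (z0 : Fin n → ℝ) (hz0 : z0 ∈ Set.range Bᵀ.mulVec)
    (δ : ℝ) (hδ : 0 < δ) (k : ℕ) (hk : 1 ≤ k) :
    ∑ s : Fin k → Fin l × Fin l,
        (∏ t, (sqnorm (Aᵀ (s t).1) / frobSq A) * (sqnorm (B (s t).2) / frobSq B)) *
          Dbreg f (rgsrrkIter A B b γ Df 0 z0 (List.ofFn s)).2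
            (Df (rgsrrkIter A B b γ Df 0 z0 (List.ofFn s)).2) xstar
      ≤ (1 + δ / γ) ^ k * (1 - γ * ν / (2 * frobSq B)) ^ k * Dbreg f z0 (Df z0) xstar
        + (δ + γ) * γ / (2 * δ * frobSq B) * spectralSq Adag *
            sqnorm ((A * Adag).mulVec b) *
          ∑ i ∈ Finset.range k,
            (1 - sminSq A / frobSq A) ^ (k - i) * (1 + δ / γ) ^ i *
              (1 - γ * ν / (2 * frobSq B)) ^ i := by
  have hD0 : 0 ≤ Dbreg f z0 (Df z0) xstar := Dbreg_nonneg ((hDf _ _).2 rfl)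
  rcases Nat.eq_zero_or_pos l with rfl | hl
  · have : Nonempty (Fin k) := ⟨⟨0, hk⟩⟩
    have hB0 : frobSq B = 0 := by simp [frobSq]
    simp only [Finset.univ_eq_empty, Finset.sum_empty, hB0, mul_zero, div_zero, zero_mul,
      add_zero, sub_zero, one_pow, mul_one]
    positivity
  have hFA : 0 < frobSq A := frobSq_pos_of_rank A (hl.trans_eq hA.symm)
  have hFB : 0 < frobSq B := frobSq_pos_of_rank B (hl.trans_eq hB.symm)
  set α := 1 - sminSq A / frobSq A
  set β := 1 - γ * ν / (2 * frobSq B)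
  have hα : 0 ≤ α := sub_nonneg.2 ((div_le_one hFA).2 (sminSq_le_frobSq A))
  have hβ : 0 ≤ β :=
    sub_nonneg.2 ((div_le_one (by positivity)).2 (mul_le_two_mul_frobSq hsc hDf hν hnu hFB))
  have hBx : B *ᵥ xstar = Adag *ᵥ b := hAdag.mulVec_eq_of_isLeast hA hB hfeas
  have hstar : Aᵀ *ᵥ (b - A *ᵥ (B *ᵥ xstar)) = 0 := by
    rw [hBx]
    exact hAdag.transpose_mulVec_residual b
  set w : Fin l × Fin l → ℝ :=
    fun c => sqnorm (Aᵀ c.1) / frobSq A * (sqnorm (B c.2) / frobSq B)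
  have hpA (j : Fin l) : 0 ≤ sqnorm (Aᵀ j) / frobSq A := div_nonneg (sqnorm_nonneg _) hFA.le
  have hpB (i : Fin l) : 0 ≤ sqnorm (B i) / frobSq B := div_nonneg (sqnorm_nonneg _) hFB.le
  have hw (c) : 0 ≤ w c := mul_nonneg (hpA _) (hpB _)
  have hsumA : ∑ j, sqnorm (Aᵀ j) / frobSq A = 1 := by
    rw [← Finset.sum_div, ← frobSq_eq_sum_cols, div_self hFA.ne']
  have hsumB : ∑ i, sqnorm (B i) / frobSq B = 1 := by
    rw [← Finset.sum_div, ← frobSq_eq_sum_rows, div_self hFB.ne']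
  set κ := γ / (2 * frobSq B) * spectralSq Adag with hκ_def
  have hκ : 0 ≤ κ := mul_nonneg (by positivity) (spectralSq_nonneg _)
  set state := rgsrrkIter A B b γ Df 0 z0
  set V : List (Fin l × Fin l) → ℝ :=
    fun cs => sqnorm (A *ᵥ ((state cs).1 - B *ᵥ xstar))
  set D : List (Fin l × Fin l) → ℝ :=
    fun cs => Dbreg f (state cs).2 (Df (state cs).2) xstar
  have hVstep (cs) : ∑ c, w c * V (c :: cs) ≤ α * V cs := by
    calc ∑ c, w c * V (c :: cs)
        = ∑ j, sqnorm (Aᵀ j) / frobSq A *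
            sqnorm (A *ᵥ (gsUpdate A b j (state cs).1 - B *ᵥ xstar)) := by
          rw [Fintype.sum_prod_type]
          refine Finset.sum_congr rfl fun j _ => ?_
          change ∑ i, sqnorm (Aᵀ j) / frobSq A * (sqnorm (B i) / frobSq B) *
            sqnorm (A *ᵥ (gsUpdate A b j (state cs).1 - B *ᵥ xstar)) = _
          rw [← Finset.sum_mul, ← Finset.mul_sum, hsumB, mul_one]
      _ ≤ α * V cs := sum_sqnorm_gsUpdate_le hstar hFA _
  have hDstep (cs) : ∑ c, w c * D (c :: cs) ≤ β * D cs + κ * α * V cs := by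
    have hz : (state cs).2 ∈ Set.range Bᵀ.mulVec := rgsrrkIter_mem_range 0 hz0 cs
    calc ∑ c, w c * D (c :: cs)
        = ∑ j, sqnorm (Aᵀ j) / frobSq A * ∑ i, sqnorm (B i) / frobSq B *
            Dbreg f (kaczmarzUpdate B γ Df i (gsUpdate A b j (state cs).1) (state cs).2)
              (Df (kaczmarzUpdate B γ Df i (gsUpdate A b j (state cs).1) (state cs).2))
              xstar := by
          rw [Fintype.sum_prod_type]
          refine Finset.sum_congr rfl fun j _ => ?_
          rw [Finset.mul_sum]
          refine Finset.sum_congr rfl fun i _ => ?_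
          rw [← mul_assoc]
          rfl
      _ ≤ ∑ j, sqnorm (Aᵀ j) / frobSq A *
            (β * D cs + κ * sqnorm (A *ᵥ (gsUpdate A b j (state cs).1 - B *ᵥ xstar))) := by
          refine Finset.sum_le_sum fun j _ => mul_le_mul_of_nonneg_left ?_ (hpA j)
          refine (sum_Dbreg_kaczmarzUpdate_le hsc hγ hDf hν hnu hFB _ hz).trans ?_
          rw [hκ_def, mul_assoc (γ / (2 * frobSq B))]
          have hdag := sqnorm_mulVec_le_spectralSq Adag
            (A *ᵥ (gsUpdate A b j (state cs).1 - B *ᵥ xstar))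
          rw [hAdag.mulVec_mulVec_cancel hA] at hdag
          gcongr
      _ = β * D cs + κ * ∑ j, sqnorm (Aᵀ j) / frobSq A *
            sqnorm (A *ᵥ (gsUpdate A b j (state cs).1 - B *ᵥ xstar)) := by
          simp_rw [mul_add, Finset.sum_add_distrib]
          rw [← Finset.sum_mul, hsumA, one_mul, Finset.mul_sum]
          congr 1
          exact Finset.sum_congr rfl fun j _ => by ring
      _ ≤ β * D cs + κ * (α * V cs) := by
          gcongr
          exact sum_sqnorm_gsUpdate_le hstar hFA _
      _ = β * D cs + κ * α * V cs := by ring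
  have hV0 : V [] = sqnorm ((A * Adag) *ᵥ b) := by
    change sqnorm (A *ᵥ (0 - B *ᵥ xstar)) = _
    rw [zero_sub, mulVec_neg, sqnorm_neg, hBx, mulVec_mulVec]
  have hmain := listExpect_le_coupled hw hα hβ hκ hVstep hDstep k
  rw [hV0] at hmain
  refine hmain.trans (add_le_add ?_ ?_)
  · have h1 : 1 ≤ (1 + δ / γ) ^ k := one_le_pow₀ (le_add_of_nonneg_right (by positivity))
    exact mul_le_mul_of_nonneg_right (le_mul_of_one_le_left (pow_nonneg hβ k) h1) hD0
  · have hδγ : κ ≤ (δ + γ) * γ / (2 * δ * frobSq B) * spectralSq Adag := by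
      refine mul_le_mul_of_nonneg_right ?_ (spectralSq_nonneg _)
      rw [div_le_div_iff₀ (by positivity) (by positivity)]
      have : 0 ≤ γ * γ * (2 * frobSq B) := by positivity
      linarith
    have hfac := hκ.trans hδγ
    have hb0 := sqnorm_nonneg ((A * Adag) *ᵥ b)
    gcongr with i hi
    have h1 : 1 ≤ (1 + δ / γ) ^ i := one_le_pow₀ (le_add_of_nonneg_right (by positivity))
    exact le_mul_of_one_le_right (pow_nonneg hα _) h1


end
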